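/- Let m_* ∈ (0,1) be the unique point with I(m_*) = 1/4, where I is the binary entropy function. For every m ∈ (m_*, 1), there exists β ≥ 0 with β²(1−m²)² ≤ 1 such that for all sufficiently small ε > 0, limsup_{N→∞} E[(1/N) log Z^{≤ε}_{N,β,m}] < 0. -/

import Mathlib

open MeasureTheory ProbabilityTheory Real Filter
open scoped NNReal

noncomputable section

/-- The law of the i.i.d. Gaussian couplings `(g_{ij})_{1 ≤ i,j ≤ N}`, each `N(0, 1/N)`. -/
def couplings (N : ℕ) : Measure (Fin N × Fin N → ℝ) :=
  Measure.pi fun _ : Fin N × Fin N => gaussianReal 0 ((N : ℝ≥0))⁻¹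

/-- The spin value (`±1`) encoded by a Boolean. -/
def spin (b : Bool) : ℝ := if b then 1 else -1

/-- The base product measure weight `p_m(σ) = ∏ i, (1 + m σ_i)/2`. -/
def pm (N : ℕ) (m : ℝ) (σ : Fin N → Bool) : ℝ :=
  ∏ i : Fin N, (1 + m * spin (σ i)) / 2

/-- The Hamiltonian `H_{N,β,m}(σ)`. -/
def ham (N : ℕ) (β m : ℝ) (g : Fin N × Fin N → ℝ) (σ : Fin N → Bool) : ℝ :=
  (β / Real.sqrt 2) * ∑ i : Fin N, ∑ j : Fin N,
      g (i, j) * (spin (σ i) - m) * (spin (σ j) - m)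
    - (β ^ 2 / (4 * N)) * ∑ i : Fin N, ∑ j : Fin N,
      (spin (σ i) - m) ^ 2 * (spin (σ j) - m) ^ 2

/-- The partition function `Z_{N,β,m}`. -/
def Z (N : ℕ) (β m : ℝ) (g : Fin N × Fin N → ℝ) : ℝ :=
  ∑ σ : Fin N → Bool, pm N m σ * Real.exp (ham N β m g σ)

/-- The set `S_{N,m,ε}` of configurations whose empirical magnetization is `ε`-close to `m`. -/
def SNset (N : ℕ) (m ε : ℝ) : Finset (Fin N → Bool) :=
  Finset.univ.filter fun σ =>
    (N : ℝ)⁻¹ * (∑ i : Fin N, spin (σ i)) ∈ Set.Icc (m - ε) (m + ε)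

/-- The restricted partition function `Z^{≤ε}_{N,β,m}`. -/
def Zres (N : ℕ) (β m ε : ℝ) (g : Fin N × Fin N → ℝ) : ℝ :=
  ∑ σ ∈ SNset N m ε, pm N m σ * Real.exp (ham N β m g σ)

/-- The quenched free energy `E[(1/N) log Z_{N,β,m}]`. -/
def F (N : ℕ) (β m : ℝ) : ℝ :=
  ∫ g, (N : ℝ)⁻¹ * Real.log (Z N β m g) ∂(couplings N)

/-- The restricted quenched free energy `F^{≤ε}_{N,β,m} = E[(1/N) log Z^{≤ε}_{N,β,m}]`. -/
def Fres (N : ℕ) (β m ε : ℝ) : ℝ :=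
  ∫ g, (N : ℝ)⁻¹ * Real.log (Zres N β m ε g) ∂(couplings N)

/-- The binary entropy function `I`. -/
def binEnt (s : ℝ) : ℝ :=
  -((1 + s) / 2) * Real.log ((1 + s) / 2) - ((1 - s) / 2) * Real.log ((1 - s) / 2)

/-- The centered Gaussian field `X_σ = (2N)^{-1/2} Σ_{ij} g_{ij} σ̂_i σ̂_j`. -/
def Xg (N : ℕ) (m : ℝ) (g : Fin N × Fin N → ℝ) (σ : Fin N → Bool) : ℝ :=
  (Real.sqrt (2 * N))⁻¹ * ∑ i : Fin N, ∑ j : Fin N,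
    g (i, j) * (spin (σ i) - m) * (spin (σ j) - m)

/-- The maximum `M_{N,m,ε} = max {X_σ : σ ∈ S_{N,m,ε}}`. -/
def Mmax (N : ℕ) (m ε : ℝ) (g : Fin N × Fin N → ℝ) : ℝ :=
  sSup ((fun σ => Xg N m g σ) '' (SNset N m ε : Set (Fin N → Bool)))

end

instance (N : ℕ) : IsProbabilityMeasure (couplings N) := by
  unfold couplings; infer_instance

section Gaussian

variable {N : ℕ} (c : Fin N × Fin N → ℝ)

lemma integrable_exp_linear :
    Integrable (fun g => Real.exp (∑ p, c p * g p)) (couplings N) := by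
  simp_rw [Real.exp_sum]
  exact Integrable.fintype_prod (f := fun p x => Real.exp (c p * x))
    fun p => integrable_exp_mul_gaussianReal (c p)

lemma integral_exp_linear :
    ∫ g, Real.exp (∑ p, c p * g p) ∂(couplings N) =
      Real.exp ((N : ℝ)⁻¹ * (∑ p, c p ^ 2) / 2) := by
  simp_rw [Real.exp_sum, couplings]
  rw [integral_fintype_prod_eq_prod (f := fun p x => Real.exp (c p * x))]
  have h : ∀ p, ∫ x, Real.exp (c p * x) ∂(gaussianReal 0 ((N : ℝ≥0))⁻¹) =
      Real.exp ((N : ℝ)⁻¹ * c p ^ 2 / 2) := by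
    intro p
    have := mgf_gaussianReal (X := id) (p := gaussianReal 0 ((N : ℝ≥0))⁻¹)
      Measure.map_id (c p)
    simpa [mgf] using this
  simp_rw [h, ← Real.exp_sum, Finset.mul_sum, Finset.sum_div]

lemma integrable_coord (p : Fin N × Fin N) : Integrable (fun g => g p) (couplings N) :=
  integrable_comp_eval (X := fun _ : Fin N × Fin N => ℝ) (i := p) (f := fun x : ℝ => x)
    (μ := fun _ => gaussianReal 0 ((N : ℝ≥0))⁻¹)
    (memLp_one_iff_integrable.1 (memLp_id_gaussianReal' 1 (by simp)))

lemma integrable_linear : Integrable (fun g => ∑ p, c p * g p) (couplings N) :=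
  integrable_finsetSum _ fun p _ => (integrable_coord p).const_mul _

lemma integral_linear : ∫ g, ∑ p, c p * g p ∂(couplings N) = 0 := by
  rw [integral_finsetSum _ fun p _ => (integrable_coord p).const_mul _]
  refine Finset.sum_eq_zero fun p _ => ?_
  rw [integral_const_mul]
  have : ∫ g, g p ∂(couplings N) = ∫ x, x ∂(gaussianReal 0 ((N : ℝ≥0))⁻¹) :=
    integral_comp_eval (X := fun _ : Fin N × Fin N => ℝ) (i := p) (f := fun x : ℝ => x)
      (μ := fun _ => gaussianReal 0 ((N : ℝ≥0))⁻¹) aestronglyMeasurable_id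
  rw [this, integral_id_gaussianReal, mul_zero]

end Gaussian

/-- The squared norm of the centered configuration. -/
noncomputable def centeredSq (N : ℕ) (m : ℝ) (σ : Fin N → Bool) : ℝ :=
  ∑ i, (spin (σ i) - m) ^ 2

/-- The coefficients of the linear part of the Hamiltonian. -/
noncomputable def hamCoef (N : ℕ) (β m : ℝ) (σ : Fin N → Bool) (p : Fin N × Fin N) : ℝ :=
  β / Real.sqrt 2 * ((spin (σ p.1) - m) * (spin (σ p.2) - m))

lemma ham_eq (N : ℕ) (β m : ℝ) (g : Fin N × Fin N → ℝ) (σ : Fin N → Bool) :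
    ham N β m g σ =
      ∑ p, hamCoef N β m σ p * g p - β ^ 2 / (4 * N) * centeredSq N m σ ^ 2 := by
  have h1 : ∑ p, hamCoef N β m σ p * g p = (β / Real.sqrt 2) * ∑ i : Fin N, ∑ j : Fin N,
      g (i, j) * (spin (σ i) - m) * (spin (σ j) - m) := by
    rw [Fintype.sum_prod_type]
    simp_rw [Finset.mul_sum, hamCoef]
    refine Finset.sum_congr rfl fun i _ => Finset.sum_congr rfl fun j _ => ?_
    ring
  rw [h1, ham, centeredSq, sq (∑ i, _), Finset.sum_mul_sum]

lemma sum_hamCoef_sq (N : ℕ) (β m : ℝ) (σ : Fin N → Bool) :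
    ∑ p, hamCoef N β m σ p ^ 2 = β ^ 2 / 2 * centeredSq N m σ ^ 2 := by
  have h2 : Real.sqrt 2 ^ 2 = 2 := Real.sq_sqrt (by norm_num)
  rw [centeredSq, sq (∑ i, _), Finset.sum_mul_sum, Fintype.sum_prod_type]
  simp_rw [Finset.mul_sum, hamCoef]
  refine Finset.sum_congr rfl fun i _ => Finset.sum_congr rfl fun j _ => ?_
  rw [mul_pow, div_pow, h2, mul_pow]

lemma exp_mul_ham (N : ℕ) (β m θ : ℝ) (g : Fin N × Fin N → ℝ) (σ : Fin N → Bool) :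
    Real.exp (θ * ham N β m g σ) = Real.exp (∑ p, (θ * hamCoef N β m σ p) * g p) *
      Real.exp (-θ * (β ^ 2 / (4 * N) * centeredSq N m σ ^ 2)) := by
  rw [← Real.exp_add, ham_eq, mul_sub, Finset.mul_sum]
  congr 1
  simp_rw [mul_assoc]
  ring

lemma integrable_exp_mul_ham (N : ℕ) (β m θ : ℝ) (σ : Fin N → Bool) :
    Integrable (fun g => Real.exp (θ * ham N β m g σ)) (couplings N) := by
  simp_rw [exp_mul_ham]
  exact (integrable_exp_linear _).mul_const _

lemma integral_exp_mul_ham (N : ℕ) (β m θ : ℝ) (σ : Fin N → Bool) :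
    ∫ g, Real.exp (θ * ham N β m g σ) ∂(couplings N) =
      Real.exp (-(θ * (1 - θ)) * (β ^ 2 / (4 * N) * centeredSq N m σ ^ 2)) := by
  simp_rw [exp_mul_ham]
  rw [integral_mul_const, integral_exp_linear, ← Real.exp_add]
  simp_rw [mul_pow]
  rw [← Finset.mul_sum, sum_hamCoef_sq]
  congr 1
  rcases eq_or_ne (N : ℝ) 0 with h | h
  · simp [h]
  · field_simp
    ring

lemma integrable_ham (N : ℕ) (β m : ℝ) (σ : Fin N → Bool) :
    Integrable (fun g => ham N β m g σ) (couplings N) := by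
  simp_rw [ham_eq]
  exact (integrable_linear _).sub (integrable_const _)

lemma integral_ham (N : ℕ) (β m : ℝ) (σ : Fin N → Bool) :
    ∫ g, ham N β m g σ ∂(couplings N) = -(β ^ 2 / (4 * N) * centeredSq N m σ ^ 2) := by
  simp_rw [ham_eq]
  rw [integral_sub (integrable_linear _) (integrable_const _), integral_linear]
  simp

lemma measurable_ham (N : ℕ) (β m : ℝ) (σ : Fin N → Bool) :
    Measurable (fun g => ham N β m g σ) := by
  unfold ham
  fun_prop

lemma one_add_mul_spin_pos {m : ℝ} (hm : m ∈ Set.Ioo (0 : ℝ) 1) (b : Bool) :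
    0 < (1 + m * spin b) / 2 := by
  obtain ⟨h0, h1⟩ := hm
  cases b <;> simp [spin] <;> linarith

lemma pm_pos (N : ℕ) {m : ℝ} (hm : m ∈ Set.Ioo (0 : ℝ) 1) (σ : Fin N → Bool) :
    0 < pm N m σ :=
  Finset.prod_pos fun i _ => one_add_mul_spin_pos hm (σ i)

lemma sum_pm (N : ℕ) (m : ℝ) : ∑ σ, pm N m σ = 1 := by
  have h := Finset.prod_univ_sum (fun _ : Fin N => (Finset.univ : Finset Bool))
    (fun _ b => (1 + m * spin b) / 2)
  rw [Fintype.piFinset_univ] at h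
  unfold pm
  rw [← h]
  refine Finset.prod_eq_one fun i _ => ?_
  simp [spin]
  ring

/-- Half of the log-odds `log ((1 + m) / (1 - m))`. -/
noncomputable def halfLogOdds (m : ℝ) : ℝ :=
  (Real.log ((1 + m) / 2) - Real.log ((1 - m) / 2)) / 2

lemma halfLogOdds_nonneg {m : ℝ} (hm : m ∈ Set.Ioo (0 : ℝ) 1) : 0 ≤ halfLogOdds m := by
  obtain ⟨h0, h1⟩ := hm
  have : Real.log ((1 - m) / 2) ≤ Real.log ((1 + m) / 2) :=
    Real.log_le_log (by linarith) (by linarith)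
  unfold halfLogOdds
  linarith

lemma log_pm (N : ℕ) {m : ℝ} (hm : m ∈ Set.Ioo (0 : ℝ) 1) (σ : Fin N → Bool) :
    Real.log (pm N m σ) =
      -(N * binEnt m) + ((∑ i, spin (σ i)) - N * m) * halfLogOdds m := by
  unfold pm
  rw [Real.log_prod fun i _ => (one_add_mul_spin_pos hm (σ i)).ne']
  have h : ∀ b, Real.log ((1 + m * spin b) / 2) =
      -binEnt m + (spin b - m) * halfLogOdds m := by
    intro b
    cases b <;> simp [spin, binEnt, halfLogOdds, ← sub_eq_add_neg] <;> ring
  simp_rw [h]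
  rw [Finset.sum_add_distrib, ← Finset.sum_mul, Finset.sum_sub_distrib]
  simp

lemma centeredSq_eq (N : ℕ) (m : ℝ) (σ : Fin N → Bool) :
    centeredSq N m σ = N * (1 + m ^ 2) - 2 * m * ∑ i, spin (σ i) := by
  have h : ∀ b, (spin b - m) ^ 2 = (1 + m ^ 2) - 2 * m * spin b := by
    intro b
    cases b <;> simp [spin] <;> ring
  unfold centeredSq
  simp_rw [h]
  rw [Finset.sum_sub_distrib, ← Finset.mul_sum]
  simp [mul_add]

lemma centeredSq_nonneg (N : ℕ) (m : ℝ) (σ : Fin N → Bool) : 0 ≤ centeredSq N m σ :=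
  Finset.sum_nonneg fun _ _ => sq_nonneg _

lemma centeredSq_le (N : ℕ) {m : ℝ} (hm : m ∈ Set.Ioo (0 : ℝ) 1) (σ : Fin N → Bool) :
    centeredSq N m σ ≤ 4 * N := by
  obtain ⟨h0, h1⟩ := hm
  have h : ∀ b, (spin b - m) ^ 2 ≤ 4 := by
    intro b
    cases b <;> simp [spin] <;> nlinarith
  calc centeredSq N m σ ≤ ∑ _i : Fin N, (4 : ℝ) := Finset.sum_le_sum fun i _ => h (σ i)
    _ = 4 * N := by simp [mul_comm]

lemma mem_SNset_iff {N : ℕ} (hN : 0 < N) {m ε : ℝ} {σ : Fin N → Bool} :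
    σ ∈ SNset N m ε ↔
      N * (m - ε) ≤ ∑ i, spin (σ i) ∧ ∑ i, spin (σ i) ≤ N * (m + ε) := by
  have hN' : (0 : ℝ) < N := by exact_mod_cast hN
  simp only [SNset, Finset.mem_filter, Finset.mem_univ, true_and, Set.mem_Icc]
  rw [inv_mul_le_iff₀ hN', le_inv_mul_iff₀ hN']

lemma SNset_nonempty {N : ℕ} (hN : 0 < N) {m ε : ℝ} (hm : m ∈ Set.Ioo (0 : ℝ) 1)
    (hNε : 2 ≤ N * ε) : (SNset N m ε).Nonempty := by
  obtain ⟨h0, h1⟩ := hm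
  have hN' : (0 : ℝ) < N := by exact_mod_cast hN
  have hx : 0 ≤ N * (1 + m) / 2 := by positivity
  set k := ⌊N * (1 + m) / 2⌋₊ with hk
  have hk1 : (k : ℝ) ≤ N * (1 + m) / 2 := Nat.floor_le hx
  have hk2 : N * (1 + m) / 2 < k + 1 := Nat.lt_floor_add_one _
  have hkN : k ≤ N := by
    have : (k : ℝ) ≤ N := hk1.trans (by nlinarith)
    exact_mod_cast this
  refine ⟨fun i => decide ((i : ℕ) < k), (mem_SNset_iff hN).2 ?_⟩
  have hs : ∑ i : Fin N, spin (decide ((i : ℕ) < k)) = 2 * k - N := by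
    have h : ∀ i : Fin N, spin (decide ((i : ℕ) < k)) =
        2 * (if (i : ℕ) < k then (1 : ℝ) else 0) - 1 := by
      intro i
      by_cases hi : (i : ℕ) < k <;> (simp [spin, hi]; try norm_num)
    simp_rw [h]
    rw [Finset.sum_sub_distrib, ← Finset.mul_sum, Finset.sum_boole, Fin.card_filter_val_lt,
      min_eq_right hkN]
    simp
  rw [hs]
  constructor <;> nlinarith

lemma rpow_sum_le_sum_rpow_of_le_one {ι : Type*} (s : Finset ι) {f : ι → ℝ}
    (hf : ∀ i ∈ s, 0 ≤ f i) {θ : ℝ} (h0 : 0 < θ) (h1 : θ ≤ 1) :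
    (∑ i ∈ s, f i) ^ θ ≤ ∑ i ∈ s, f i ^ θ :=
  Finset.le_sum_of_subadditive_on_pred (fun x : ℝ => x ^ θ) (fun x => 0 ≤ x)
    (by simp [Real.zero_rpow h0.ne'])
    (fun _ _ hx hy => Real.rpow_add_le_add_rpow hx hy h0.le h1)
    (fun _ _ hx hy => add_nonneg hx hy) f hf

/-- Jensen's inequality for the logarithm. -/
lemma integral_log_le_log {Ω : Type*} [MeasurableSpace Ω] {μ : Measure Ω}
    [IsProbabilityMeasure μ] {W : Ω → ℝ} {a : ℝ} (ha : 0 < a) (hW : ∀ ω, 0 < W ω)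
    (hWi : Integrable W μ) (hlog : Integrable (fun ω => Real.log (W ω)) μ)
    (hWa : ∫ ω, W ω ∂μ ≤ a) : ∫ ω, Real.log (W ω) ∂μ ≤ Real.log a := by
  have h : ∀ ω, Real.log (W ω) ≤ a⁻¹ * W ω + (Real.log a - 1) := by
    intro ω
    have := Real.log_le_sub_one_of_pos (mul_pos (inv_pos.2 ha) (hW ω))
    rw [Real.log_mul (inv_pos.2 ha).ne' (hW ω).ne', Real.log_inv] at this
    linarith
  calc ∫ ω, Real.log (W ω) ∂μ ≤ ∫ ω, (a⁻¹ * W ω + (Real.log a - 1)) ∂μ :=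
        integral_mono hlog ((hWi.const_mul _).add (integrable_const _)) h
    _ = a⁻¹ * ∫ ω, W ω ∂μ + (Real.log a - 1) := by
        rw [integral_add (hWi.const_mul _) (integrable_const _), integral_const_mul]
        simp
    _ ≤ a⁻¹ * a + (Real.log a - 1) := by gcongr
    _ = Real.log a := by rw [inv_mul_cancel₀ ha.ne']; ring

section FreeEnergy

variable {N : ℕ} {β m ε θ : ℝ}

lemma Zres_pos (hm : m ∈ Set.Ioo (0 : ℝ) 1) (hS : (SNset N m ε).Nonempty)
    (g : Fin N × Fin N → ℝ) : 0 < Zres N β m ε g :=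
  Finset.sum_pos (fun σ _ => mul_pos (pm_pos N hm σ) (Real.exp_pos _)) hS

lemma log_le_log_Zres (hm : m ∈ Set.Ioo (0 : ℝ) 1) {σ : Fin N → Bool} (hσ : σ ∈ SNset N m ε)
    (g : Fin N × Fin N → ℝ) :
    Real.log (pm N m σ) + ham N β m g σ ≤ Real.log (Zres N β m ε g) := by
  have h := Finset.single_le_sum
    (f := fun σ => pm N m σ * Real.exp (ham N β m g σ))
    (fun σ _ => (mul_pos (pm_pos N hm σ) (Real.exp_pos _)).le) hσ
  have := Real.log_le_log (mul_pos (pm_pos N hm σ) (Real.exp_pos (ham N β m g σ))) h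
  rwa [Real.log_mul (pm_pos N hm σ).ne' (Real.exp_pos _).ne', Real.log_exp] at this

lemma integrable_log_Zres (hm : m ∈ Set.Ioo (0 : ℝ) 1) (hS : (SNset N m ε).Nonempty) :
    Integrable (fun g => Real.log (Zres N β m ε g)) (couplings N) := by
  obtain ⟨σ, hσ⟩ := hS
  have hmeas : Measurable (fun g => Real.log (Zres N β m ε g)) := by
    refine Real.measurable_log.comp (Finset.measurable_sum _ fun τ _ => ?_)
    exact (Real.measurable_exp.comp (measurable_ham N β m τ)).const_mul _
  refine integrable_of_le_of_le hmeas.aestronglyMeasurable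
    (g₁ := fun g => Real.log (pm N m σ) + ham N β m g σ) (g₂ := fun g => Zres N β m ε g)
    (ae_of_all _ fun g => log_le_log_Zres hm hσ g)
    (ae_of_all _ fun g => Real.log_le_self (Zres_pos hm ⟨σ, hσ⟩ g).le)
    ((integrable_const _).add (integrable_ham N β m σ)) ?_
  refine integrable_finsetSum _ fun τ _ => ?_
  simpa using (integrable_exp_mul_ham N β m 1 τ).const_mul (pm N m τ)

lemma log_pm_ge (hN : 0 < N) (hm : m ∈ Set.Ioo (0 : ℝ) 1) {σ : Fin N → Bool}
    (hσ : σ ∈ SNset N m ε) :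
    -(N * (binEnt m + halfLogOdds m * ε)) ≤ Real.log (pm N m σ) := by
  have h := ((mem_SNset_iff hN).1 hσ).1
  rw [log_pm N hm]
  nlinarith [mul_nonneg (sub_nonneg.2 h) (halfLogOdds_nonneg hm)]

lemma Fres_ge (hN : 0 < N) (hm : m ∈ Set.Ioo (0 : ℝ) 1) (hS : (SNset N m ε).Nonempty) :
    -(binEnt m + halfLogOdds m * ε) - 4 * β ^ 2 ≤ Fres N β m ε := by
  have hN' : (0 : ℝ) < N := by exact_mod_cast hN
  have hi := integrable_log_Zres (β := β) hm hS
  obtain ⟨σ, hσ⟩ := hS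
  have h1 : Real.log (pm N m σ) - β ^ 2 / (4 * N) * centeredSq N m σ ^ 2 ≤
      ∫ g, Real.log (Zres N β m ε g) ∂(couplings N) := by
    have := integral_mono ((integrable_const (Real.log (pm N m σ))).add
      (integrable_ham N β m σ)) hi fun g => log_le_log_Zres hm hσ g
    simp only [Pi.add_apply] at this
    rw [integral_add (integrable_const _) (integrable_ham N β m σ), integral_ham] at this
    simpa [sub_eq_add_neg] using this
  have h2 : β ^ 2 / (4 * N) * centeredSq N m σ ^ 2 ≤ N * (4 * β ^ 2) := by
    calc β ^ 2 / (4 * N) * centeredSq N m σ ^ 2 ≤ β ^ 2 / (4 * N) * (4 * N) ^ 2 := by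
          have := centeredSq_nonneg N m σ
          gcongr
          exact centeredSq_le N hm σ
      _ = N * (4 * β ^ 2) := by field_simp
  have h3 := log_pm_ge hN hm hσ
  rw [Fres, integral_const_mul, le_inv_mul_iff₀ hN']
  linarith

lemma sum_fractional_moment_le (hN : 0 < N) (hm : m ∈ Set.Ioo (0 : ℝ) 1)
    (ha : 0 ≤ 1 - m ^ 2 - 2 * m * ε) (h0 : 0 < θ) (h1 : θ < 1) :
    ∑ σ ∈ SNset N m ε, pm N m σ ^ θ * ∫ g, Real.exp (θ * ham N β m g σ) ∂(couplings N) ≤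
      Real.exp (N * ((1 - θ) * (binEnt m + halfLogOdds m * ε -
        θ * (β ^ 2 * (1 - m ^ 2 - 2 * m * ε) ^ 2 / 4)))) := by
  have hN' : (0 : ℝ) < N := by exact_mod_cast hN
  set a := 1 - m ^ 2 - 2 * m * ε with ha'
  set E := Real.exp (N * ((1 - θ) * (binEnt m + halfLogOdds m * ε - θ * (β ^ 2 * a ^ 2 / 4))))
    with hE
  have key : ∀ σ ∈ SNset N m ε,
      pm N m σ ^ θ * ∫ g, Real.exp (θ * ham N β m g σ) ∂(couplings N) ≤ pm N m σ * E := by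
    intro σ hσ
    have hl := log_pm_ge hN hm hσ
    have hA : N * a ≤ centeredSq N m σ := by
      have := ((mem_SNset_iff hN).1 hσ).2
      rw [centeredSq_eq]
      nlinarith [hm.1]
    have hq : N * (β ^ 2 * a ^ 2 / 4) ≤ β ^ 2 / (4 * N) * centeredSq N m σ ^ 2 := by
      calc N * (β ^ 2 * a ^ 2 / 4) = β ^ 2 / (4 * N) * (N * a) ^ 2 := by field_simp
        _ ≤ _ := by gcongr
    rw [integral_exp_mul_ham, Real.rpow_def_of_pos (pm_pos N hm σ), ← Real.exp_add]
    refine le_of_le_of_eq (Real.exp_le_exp.2 ?_)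
      ((Real.exp_add _ _).trans (congrArg (· * E) (Real.exp_log (pm_pos N hm σ))))
    have e1 := mul_le_mul_of_nonneg_left hl (sub_nonneg.2 h1.le)
    have e2 := mul_le_mul_of_nonneg_left hq (mul_nonneg h0.le (sub_nonneg.2 h1.le))
    linarith
  calc _ ≤ ∑ σ ∈ SNset N m ε, pm N m σ * E := Finset.sum_le_sum key
    _ ≤ ∑ σ, pm N m σ * E :=
        Finset.sum_le_sum_of_subset_of_nonneg (Finset.subset_univ _)
          fun σ _ _ => (mul_pos (pm_pos N hm σ) (Real.exp_pos _)).le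
    _ = E := by rw [← Finset.sum_mul, sum_pm, one_mul]

/-- The fractional moment bound on the restricted quenched free energy. -/
lemma Fres_le (hN : 0 < N) (hm : m ∈ Set.Ioo (0 : ℝ) 1) (hS : (SNset N m ε).Nonempty)
    (ha : 0 ≤ 1 - m ^ 2 - 2 * m * ε) (h0 : 0 < θ) (h1 : θ < 1) :
    Fres N β m ε ≤ θ⁻¹ * ((1 - θ) * (binEnt m + halfLogOdds m * ε -
        θ * (β ^ 2 * (1 - m ^ 2 - 2 * m * ε) ^ 2 / 4))) := by
  have hN' : (0 : ℝ) < N := by exact_mod_cast hN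
  have hi := integrable_log_Zres (β := β) hm hS
  set W : (Fin N × Fin N → ℝ) → ℝ := fun g => Zres N β m ε g ^ θ with hW
  have hWle : ∀ g, W g ≤ ∑ σ ∈ SNset N m ε, pm N m σ ^ θ * Real.exp (θ * ham N β m g σ) := by
    intro g
    refine (rpow_sum_le_sum_rpow_of_le_one _
      (fun σ _ => (mul_pos (pm_pos N hm σ) (Real.exp_pos _)).le) h0 h1.le).trans_eq ?_
    refine Finset.sum_congr rfl fun σ _ => ?_
    rw [Real.mul_rpow (pm_pos N hm σ).le (Real.exp_pos _).le, ← Real.exp_mul, mul_comm θ]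
  have hWpos : ∀ g, 0 < W g := fun g => Real.rpow_pos_of_pos (Zres_pos hm hS g) θ
  have hVi : ∀ σ ∈ SNset N m ε,
      Integrable (fun g => pm N m σ ^ θ * Real.exp (θ * ham N β m g σ)) (couplings N) :=
    fun σ _ => (integrable_exp_mul_ham N β m θ σ).const_mul _
  have hZmeas : Measurable (fun g => Zres N β m ε g) :=
    Finset.measurable_sum _ fun τ _ =>
      (Real.measurable_exp.comp (measurable_ham N β m τ)).const_mul _
  have hWi : Integrable W (couplings N) :=
    integrable_of_le_of_le (hZmeas.pow_const θ).aestronglyMeasurable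
      (ae_of_all _ fun g => (hWpos g).le) (ae_of_all _ hWle) (integrable_zero _ _ _)
      (integrable_finsetSum _ hVi)
  have hlog : ∀ g, Real.log (W g) = θ * Real.log (Zres N β m ε g) := fun g =>
    Real.log_rpow (Zres_pos hm hS g) θ
  have hint : ∫ g, W g ∂(couplings N) ≤ Real.exp (N * ((1 - θ) * (binEnt m +
      halfLogOdds m * ε - θ * (β ^ 2 * (1 - m ^ 2 - 2 * m * ε) ^ 2 / 4)))) := by
    refine (integral_mono hWi (integrable_finsetSum _ hVi) hWle).trans ?_
    rw [integral_finsetSum _ hVi]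
    simp_rw [integral_const_mul]
    exact sum_fractional_moment_le hN hm ha h0 h1
  have hJ := integral_log_le_log (Real.exp_pos _) hWpos hWi
    (by simpa only [hlog] using hi.const_mul θ) hint
  simp_rw [hlog] at hJ
  rw [integral_const_mul, Real.log_exp] at hJ
  rw [Fres, integral_const_mul, inv_mul_le_iff₀ hN', mul_left_comm, le_inv_mul_iff₀ h0]
  exact hJ

end FreeEnergy

lemma binEnt_eq_binEntropy (s : ℝ) : binEnt s = Real.binEntropy ((1 + s) / 2) := by
  rw [binEnt, Real.binEntropy, Real.log_inv, Real.log_inv,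
    show 1 - (1 + s) / 2 = (1 - s) / 2 by ring]
  ring

lemma binEnt_lt_binEnt {s t : ℝ} (hs : 0 ≤ s) (hst : s < t) (ht : t ≤ 1) :
    binEnt t < binEnt s := by
  rw [binEnt_eq_binEntropy, binEnt_eq_binEntropy]
  refine Real.binEntropy_strictAntiOn ⟨?_, ?_⟩ ⟨?_, ?_⟩ ?_ <;> linarith

lemma binEnt_nonneg {s : ℝ} (hs : s ∈ Set.Ioo (0 : ℝ) 1) : 0 ≤ binEnt s := by
  rw [binEnt_eq_binEntropy]
  exact Real.binEntropy_nonneg (by linarith [hs.1]) (by linarith [hs.2])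

/-- if `m_* ∈ (0,1)` satisfies `I(m_*) = 1/4`, then for every `m ∈ (m_*, 1)` there
is `β ≥ 0` with `β²(1-m²)² ≤ 1` such that for all sufficiently small `ε > 0`,
`limsup_{N→∞} E[(1/N) log Z^{≤ε}_{N,β,m}] < 0`. -/
theorem statement3 (mstar : ℝ) (hms : mstar ∈ Set.Ioo (0 : ℝ) 1) (hmsI : binEnt mstar = 1 / 4)
    (m : ℝ) (hm : m ∈ Set.Ioo mstar 1) :
    ∃ β : ℝ, 0 ≤ β ∧ β ^ 2 * (1 - m ^ 2) ^ 2 ≤ 1 ∧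
      ∃ ε₀ > (0 : ℝ), ∀ ε ∈ Set.Ioo (0 : ℝ) ε₀,
        limsup (fun N : ℕ => Fres N β m ε) atTop < 0 := by
  have hm01 : m ∈ Set.Ioo (0 : ℝ) 1 := ⟨hms.1.trans hm.1, hm.2⟩
  have hI : binEnt m < 1 / 4 := hmsI ▸ binEnt_lt_binEnt hms.1.le hm.1 hm.2.le
  have hI0 := binEnt_nonneg hm01
  have hv : 0 < 1 - m ^ 2 := by nlinarith [hm01.1, hm01.2]
  set β := (1 - m ^ 2)⁻¹ with hβ
  have hβv : β ^ 2 * (1 - m ^ 2) ^ 2 = 1 := by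
    rw [← mul_pow, inv_mul_cancel₀ hv.ne', one_pow]
  refine ⟨β, (inv_pos.2 hv).le, hβv.le, ?_⟩
  obtain ⟨θ, hθI, hθ1⟩ := exists_between (show 4 * binEnt m < 1 by linarith)
  have hθ0 : 0 < θ := by linarith
  set f : ℝ → ℝ := fun ε => θ⁻¹ * ((1 - θ) * (binEnt m + halfLogOdds m * ε -
        θ * (β ^ 2 * (1 - m ^ 2 - 2 * m * ε) ^ 2 / 4))) with hf
  have hf0 : f 0 < 0 := by
    simp only [hf, mul_zero, sub_zero, add_zero, hβv]
    exact mul_neg_of_pos_of_neg (inv_pos.2 hθ0)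
      (mul_neg_of_pos_of_neg (by linarith) (by linarith))
  have hfc : Continuous f := by fun_prop
  have hac : Continuous fun ε : ℝ => 1 - m ^ 2 - 2 * m * ε := by fun_prop
  have hev : ∀ᶠ ε in nhds (0 : ℝ), f ε < 0 ∧ 0 < 1 - m ^ 2 - 2 * m * ε :=
    (hfc.continuousAt.eventually_lt_const hf0).and
      (hac.continuousAt.eventually_const_lt (by simpa using hv))
  obtain ⟨ε₀, hε₀, hball⟩ := Metric.eventually_nhds_iff.1 hev
  refine ⟨ε₀, hε₀, fun ε hε => ?_⟩
  obtain ⟨hfε, haε⟩ := hball (y := ε) (by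
    rw [Real.dist_eq, sub_zero, abs_of_pos hε.1]
    exact hε.2)
  have hlarge : ∀ᶠ N : ℕ in atTop, 0 < N ∧ (SNset N m ε).Nonempty := by
    filter_upwards [eventually_gt_atTop 0, eventually_ge_atTop ⌈2 / ε⌉₊] with N hN hN2
    refine ⟨hN, SNset_nonempty hN hm01 ?_⟩
    rw [← div_le_iff₀ hε.1]
    exact Nat.ceil_le.1 hN2
  refine lt_of_le_of_lt (limsup_le_of_le ?_ ?_) hfε
  · refine IsBoundedUnder.isCoboundedUnder_le
      (isBoundedUnder_of_eventually_ge
        (a := -(binEnt m + halfLogOdds m * ε) - 4 * β ^ 2) ?_)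
    filter_upwards [hlarge] with N hN using Fres_ge hN.1 hm01 hN.2
  · filter_upwards [hlarge] with N hN using Fres_le hN.1 hm01 hN.2 haε.le hθ0 hθ1
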